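/- arXiv:1501.01695 — 2 statements merged into one kernel-verified Lean document; each statement's English description precedes it below -/
import Mathlib

section
/- Let n ∈ ℕ, fix x₀ ∈ ℝ^n with ‖x₀‖ = 1, let c_g be a positive constant with the order-statistics property below, and set ε_g := sup_{x ≥ 2} (c_g² ln(2x) − 1)/(x − 1). Then for every α > 0, every C > 0, and every ε with 0 < ε < min(1, ε_g), one has β^max_{ε,α,C} < (1 + ε_g^{−1})ε/(c_g² ln(2ε_g/ε)). -/
open MeasureTheory ProbabilityTheory Real

/-- The canonical probability space of `m` i.i.d. standard Gaussian random variables. -/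
noncomputable def stdGaussianPi (m : ℕ) : Measure (Fin m → ℝ) :=
  Measure.pi fun _ => gaussianReal 0 1

/-- The law of an `m × n` Gaussian random matrix with i.i.d. `N(0,1)` entries. -/
noncomputable def gaussianMatrix (m n : ℕ) : Measure (Fin m → Fin n → ℝ) :=
  Measure.pi fun _ => Measure.pi fun _ => gaussianReal 0 1

/-- `absOrd y j = |Y_(j+1)|`: the `(j+1)`-st largest among `|y 0|, …, |y (m-1)|`. -/
noncomputable def absOrd {m : ℕ} (y : Fin m → ℝ) (j : Fin m) : ℝ :=
  |y (Tuple.sort (fun i => -|y i|) j)|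

/-- `c` has the order-statistics property: `c √(ln(2m/(j+1))) ≤ E|Y_(j+1)|` for
all `m` and all `j+1 ≤ m/2`. -/
def cgProperty (c : ℝ) : Prop :=
  ∀ (m : ℕ) (j : Fin m), 2 * ((j : ℕ) + 1) ≤ m →
    c * Real.sqrt (Real.log (2 * m / ((j : ℕ) + 1))) ≤ ∫ y, absOrd y j ∂(stdGaussianPi m)

/-- `‖A_T x‖²`. -/
noncomputable def subNormSq {m n : ℕ} (A : Fin m → Fin n → ℝ) (x : Fin n → ℝ)
    (T : Finset (Fin m)) : ℝ :=
  ∑ i ∈ T, (∑ j, A i j * x j) ^ 2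

/-- The event `Ω_{ε,β}`. -/
def omegaEvent (m n : ℕ) (x₀ : Fin n → ℝ) (ε β : ℝ) : Set (Fin m → Fin n → ℝ) :=
  {A | ∀ T : Finset (Fin m), (Tᶜ.card : ℝ) ≤ β * m →
    |(1 / (T.card : ℝ)) * subNormSq A x₀ T - 1| ≤ ε}

/-- `β^max_{ε,α,C}`: the supremum of all `β ∈ (0,1)` such that
`P(Ω_{ε,β}) ≥ 1 − C e^{−α(ε²/4−ε³/6)m}` for all sufficiently large `m`
(with `sSup ∅ = 0` in `ℝ`). -/
noncomputable def betaMaxC (n : ℕ) (x₀ : Fin n → ℝ) (ε α C : ℝ) : ℝ :=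
  sSup {β : ℝ | 0 < β ∧ β < 1 ∧ ∃ M : ℕ, ∀ m : ℕ, M ≤ m →
    ENNReal.ofReal (1 - C * Real.exp (-α * (ε ^ 2 / 4 - ε ^ 3 / 6) * m)) ≤
      gaussianMatrix m n (omegaEvent m n x₀ ε β)}

open Filter Topology

/-- The event on `ℝ^m` whose preimage under `A ↦ A x₀` is `Ω_{ε,β}`. -/
def coordEvent (m : ℕ) (ε β : ℝ) : Set (Fin m → ℝ) :=
  {y | ∀ T : Finset (Fin m), (Tᶜ.card : ℝ) ≤ β * m →
    |(1 / (T.card : ℝ)) * (∑ i ∈ T, y i ^ 2) - 1| ≤ ε}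

lemma measurableSet_coordEvent (m : ℕ) (ε β : ℝ) : MeasurableSet (coordEvent m ε β) := by
  have : coordEvent m ε β = ⋂ T : Finset (Fin m), ⋂ _ : (Tᶜ.card : ℝ) ≤ β * m,
      {y | |(1 / (T.card : ℝ)) * (∑ i ∈ T, y i ^ 2) - 1| ≤ ε} := by
    ext y; simp [coordEvent]
  rw [this]
  refine MeasurableSet.iInter fun T => MeasurableSet.iInter fun _ => ?_
  exact (isClosed_le (by fun_prop) continuous_const).measurableSet

/-- The scalar product of a standard Gaussian vector with a unit vector is standard Gaussian. -/
lemma map_dotProduct_pi_gaussianReal {n : ℕ} (x : Fin n → ℝ) (hx : ∑ j, x j ^ 2 = 1) :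
    (Measure.pi fun _ : Fin n => gaussianReal 0 1).map (fun a => ∑ j, a j * x j)
      = gaussianReal 0 1 := by
  let L : StrongDual ℝ (EuclideanSpace ℝ (Fin n)) := innerSL ℝ (WithLp.toLp 2 x)
  have hcomp : (fun a : Fin n → ℝ => ∑ j, a j * x j) = L ∘ WithLp.toLp 2 := by
    ext a; simp [L, PiLp.inner_apply]
  have hL : ‖L‖ ^ 2 = 1 := by
    simp [L, innerSL_apply_norm, EuclideanSpace.real_norm_sq_eq, hx]
  rw [hcomp, ← Measure.map_map L.continuous.measurable (by fun_prop), map_pi_eq_stdGaussian,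
    IsGaussian.map_eq_gaussianReal, variance_dual_stdGaussian, integral_strongDual_stdGaussian, hL]
  simp

lemma map_mulVec_gaussianMatrix {m n : ℕ} (x : Fin n → ℝ) (hx : ∑ j, x j ^ 2 = 1) :
    (gaussianMatrix m n).map (fun A i => ∑ j, A i j * x j) = stdGaussianPi m := by
  have h := map_dotProduct_pi_gaussianReal x hx
  have : SigmaFinite ((Measure.pi fun _ : Fin n => gaussianReal 0 1).map
      (fun a => ∑ j, a j * x j)) := by rw [h]; infer_instance
  unfold gaussianMatrix stdGaussianPi
  rw [Measure.pi_map_pi (f := fun _ (a : Fin n → ℝ) => ∑ j, a j * x j)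
    (fun _ => Measurable.aemeasurable (by fun_prop))]
  simp_rw [h]

lemma gaussianMatrix_omegaEvent {m n : ℕ} (x : Fin n → ℝ) (hx : ∑ j, x j ^ 2 = 1) (ε β : ℝ) :
    gaussianMatrix m n (omegaEvent m n x ε β) = stdGaussianPi m (coordEvent m ε β) := by
  rw [← map_mulVec_gaussianMatrix x hx,
    Measure.map_apply (by fun_prop) (measurableSet_coordEvent m ε β)]
  rfl

instance (m : ℕ) : IsProbabilityMeasure (stdGaussianPi m) := by
  unfold stdGaussianPi; infer_instance

lemma integrable_sq_gaussianReal : Integrable (fun x : ℝ => x ^ 2) (gaussianReal 0 1) :=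
  (memLp_id_gaussianReal' 2 (by simp)).integrable_sq

lemma integral_sq_gaussianReal : ∫ x, x ^ 2 ∂(gaussianReal 0 1) = 1 := by
  have h := variance_fun_id_gaussianReal (μ := 0) (v := 1)
  rw [variance_eq_integral measurable_id'.aemeasurable] at h
  simpa using h

lemma integrable_coord_sq {m : ℕ} (i : Fin m) :
    Integrable (fun y : Fin m → ℝ => y i ^ 2) (stdGaussianPi m) :=
  integrable_comp_eval (μ := fun _ : Fin m => gaussianReal 0 1) (i := i)
    (f := fun x : ℝ => x ^ 2) integrable_sq_gaussianReal

lemma integral_coord_sq {m : ℕ} (i : Fin m) : ∫ y, y i ^ 2 ∂(stdGaussianPi m) = 1 :=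
  (integral_comp_eval (μ := fun _ : Fin m => gaussianReal 0 1) (i := i)
    (f := fun x : ℝ => x ^ 2) (by fun_prop)).trans integral_sq_gaussianReal

lemma integrable_sum_sq (m : ℕ) :
    Integrable (fun y : Fin m → ℝ => ∑ i, y i ^ 2) (stdGaussianPi m) :=
  integrable_finsetSum _ fun i _ => integrable_coord_sq i

lemma integral_sum_sq (m : ℕ) : ∫ y, ∑ i, y i ^ 2 ∂(stdGaussianPi m) = m := by
  rw [integral_finsetSum _ fun i _ => integrable_coord_sq i]
  simp [integral_coord_sq]

/-- The indices of the `j + 1` entries of `y` that are largest in absolute value. -/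
noncomputable def topIndices {m : ℕ} (y : Fin m → ℝ) (j : Fin m) : Finset (Fin m) :=
  (Finset.Iic j).map (Tuple.sort fun i => -|y i|).toEmbedding

lemma card_topIndices {m : ℕ} (y : Fin m → ℝ) (j : Fin m) :
    (topIndices y j).card = (j : ℕ) + 1 := by
  simp [topIndices]

lemma card_mul_absOrd_sq_le {m : ℕ} (y : Fin m → ℝ) (j : Fin m) :
    ((j : ℝ) + 1) * absOrd y j ^ 2 ≤ ∑ i ∈ topIndices y j, y i ^ 2 := by
  have h := Finset.card_nsmul_le_sum (topIndices y j) (fun i => y i ^ 2) (absOrd y j ^ 2) ?_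
  · simpa [card_topIndices] using h
  · intro i hi
    obtain ⟨l, hl, rfl⟩ := Finset.mem_map.1 hi
    have hmono := Tuple.monotone_sort (fun i => -|y i|) (Finset.mem_Iic.1 hl)
    simp only [Function.comp_apply, neg_le_neg_iff] at hmono
    rw [absOrd, Equiv.coe_toEmbedding, sq_le_sq, abs_abs]
    exact hmono

lemma absOrd_sq_add_indicator_le {m : ℕ} {ε β : ℝ} (j : Fin m)
    (hj : (j : ℝ) + 1 ≤ β * m) (hjm : (j : ℕ) + 1 < m) (y : Fin m → ℝ) :
    ((j : ℝ) + 1) * absOrd y j ^ 2 +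
      (coordEvent m ε β).indicator (fun _ => (1 - ε) * (m - (j + 1))) y ≤ ∑ i, y i ^ 2 := by
  have htop := card_mul_absOrd_sq_le y j
  have hsplit := Finset.sum_add_sum_compl (topIndices y j) fun i => y i ^ 2
  by_cases hy : y ∈ coordEvent m ε β
  · rw [Set.indicator_of_mem hy]
    have hcard : ((topIndices y j)ᶜ.card : ℝ) = m - (j + 1) := by
      rw [Finset.card_compl, card_topIndices, Fintype.card_fin, Nat.cast_sub hjm.le]
      push_cast; rfl
    have hpos : (0 : ℝ) < m - (j + 1) := by
      have : ((j : ℕ) : ℝ) + 1 < m := by exact_mod_cast hjm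
      linarith
    have h := hy (topIndices y j)ᶜ (by rw [compl_compl, card_topIndices]; exact_mod_cast hj)
    rw [hcard, one_div_mul_eq_div] at h
    have h' : 1 - ε ≤ (∑ i ∈ (topIndices y j)ᶜ, y i ^ 2) / (m - (j + 1)) := by
      linarith [(abs_le.1 h).1]
    rw [le_div_iff₀ hpos] at h'
    linarith
  · rw [Set.indicator_of_notMem hy]
    have : 0 ≤ ∑ i ∈ (topIndices y j)ᶜ, y i ^ 2 := Finset.sum_nonneg fun i _ => sq_nonneg _
    linarith

/-- Integrating `absOrd_sq_add_indicator_le` against a lower bound for `E|Y_(j+1)|`. -/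
lemma order_stat_bound {m : ℕ} {ε β a : ℝ} (j : Fin m) (ha : 0 < a)
    (hE : a ≤ ∫ y, absOrd y j ∂(stdGaussianPi m))
    (hj : (j : ℝ) + 1 ≤ β * m) (hjm : (j : ℕ) + 1 < m) :
    ((j : ℝ) + 1) * a ^ 2 +
      (stdGaussianPi m).real (coordEvent m ε β) * ((1 - ε) * (m - (j + 1))) ≤ m := by
  have hint : Integrable (fun y => absOrd y j) (stdGaussianPi m) := by
    by_contra h
    rw [integral_undef h] at hE
    linarith
  have hind : Integrable ((coordEvent m ε β).indicator
      fun _ => (1 - ε) * ((m : ℝ) - ((j : ℝ) + 1))) (stdGaussianPi m) :=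
    (integrable_const _).indicator (measurableSet_coordEvent m ε β)
  have hlin : Integrable (fun y => ((j : ℝ) + 1) * (2 * a * absOrd y j - a ^ 2))
      (stdGaussianPi m) := ((hint.const_mul _).sub (integrable_const _)).const_mul _
  have h := integral_mono (hlin.add hind) (integrable_sum_sq m) fun y => by
    refine le_trans ?_ (absOrd_sq_add_indicator_le (ε := ε) j hj hjm y)
    simp only [Pi.add_apply]
    gcongr
    nlinarith [sq_nonneg (absOrd y j - a)]
  rw [integral_sum_sq, integral_add' hlin hind, integral_const_mul,
    integral_sub (hint.const_mul _) (integrable_const _), integral_const_mul,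
    integral_indicator_const _ (measurableSet_coordEvent m ε β)] at h
  simp only [integral_const, probReal_univ, smul_eq_mul, one_mul] at h
  refine le_trans ?_ h
  gcongr
  nlinarith

/-- The set over which `betaMaxC` is the supremum. -/
def admissible (n : ℕ) (x₀ : Fin n → ℝ) (ε α C : ℝ) : Set ℝ :=
  {β : ℝ | 0 < β ∧ β < 1 ∧ ∃ M : ℕ, ∀ m : ℕ, M ≤ m →
    ENNReal.ofReal (1 - C * Real.exp (-α * (ε ^ 2 / 4 - ε ^ 3 / 6) * m)) ≤
      gaussianMatrix m n (omegaEvent m n x₀ ε β)}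

lemma admissible_of_le {n : ℕ} {x₀ : Fin n → ℝ} {ε α C β b : ℝ}
    (hβ : β ∈ admissible n x₀ ε α C) (hb : 0 < b) (hbβ : b ≤ β) :
    b ∈ admissible n x₀ ε α C := by
  obtain ⟨-, hβ1, M, hM⟩ := hβ
  refine ⟨hb, hbβ.trans_lt hβ1, M, fun m hm => (hM m hm).trans (measure_mono ?_)⟩
  intro A hA T hT
  exact hA T (hT.trans (by gcongr))

lemma log_bound_of_admissible {n : ℕ} {x₀ : Fin n → ℝ} (hx₀ : ∑ j, x₀ j ^ 2 = 1)
    {cg : ℝ} (hcg : 0 < cg) (hcgProp : cgProperty cg) {ε α C b : ℝ} (hα : 0 < α)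
    (hε0 : 0 < ε) (hε1 : ε < 1) (hb : b ∈ admissible n x₀ ε α C) (hb2 : b ≤ 1 / 2) :
    b * (cg ^ 2 * Real.log (2 / b)) ≤ ε + (1 - ε) * b := by
  obtain ⟨hb0, -, M, hM⟩ := hb
  set r := α * (ε ^ 2 / 4 - ε ^ 3 / 6) with hr
  have hr0 : 0 < r := mul_pos hα (by nlinarith [pow_pos hε0 2])
  have hlog : 0 < Real.log (2 / b) := Real.log_pos (by rw [lt_div_iff₀ hb0]; linarith)
  have hfloor : Tendsto (fun m : ℕ => ((⌊b * m⌋₊ : ℕ) : ℝ) / m) atTop (𝓝 b) :=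
    (tendsto_nat_floor_mul_div_atTop hb0.le).comp tendsto_natCast_atTop_atTop
  have hexp : Tendsto (fun m : ℕ => C * Real.exp (-r * m)) atTop (𝓝 0) := by
    have : Tendsto (fun m : ℕ => -r * (m : ℝ)) atTop atBot :=
      tendsto_natCast_atTop_atTop.const_mul_atTop_of_neg (by linarith)
    simpa using (Real.tendsto_exp_atBot.comp this).const_mul C
  have hlim : Tendsto (fun m : ℕ => ((⌊b * m⌋₊ : ℕ) : ℝ) / m * (cg ^ 2 * Real.log (2 / b)) +
      (1 - C * Real.exp (-r * m)) * ((1 - ε) * (1 - ((⌊b * m⌋₊ : ℕ) : ℝ) / m))) atTop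
      (𝓝 (b * (cg ^ 2 * Real.log (2 / b)) + (1 - 0) * ((1 - ε) * (1 - b)))) :=
    (hfloor.mul_const _).add
      ((tendsto_const_nhds.sub hexp).mul ((tendsto_const_nhds.sub hfloor).const_mul _))
  suffices h : ∀ᶠ m : ℕ in atTop, ((⌊b * m⌋₊ : ℕ) : ℝ) / m * (cg ^ 2 * Real.log (2 / b)) +
      (1 - C * Real.exp (-r * m)) * ((1 - ε) * (1 - ((⌊b * m⌋₊ : ℕ) : ℝ) / m)) ≤ 1 by
    have := le_of_tendsto hlim h
    nlinarith
  filter_upwards [eventually_ge_atTop M, eventually_ge_atTop ⌈1 / b⌉₊, eventually_ge_atTop 1]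
    with m hmM hmb hm1
  have hm0 : (0 : ℝ) < m := by exact_mod_cast hm1
  have hbm : 1 ≤ b * m := by
    have := (Nat.ceil_le.1 hmb)
    rw [div_le_iff₀ hb0] at this
    linarith
  have hk1 : 1 ≤ ⌊b * (m : ℝ)⌋₊ := Nat.le_floor (by exact_mod_cast hbm)
  have hkle : ((⌊b * (m : ℝ)⌋₊ : ℕ) : ℝ) ≤ b * m := Nat.floor_le (by linarith)
  obtain ⟨j, hjk⟩ : ∃ j, ⌊b * (m : ℝ)⌋₊ = j + 1 := ⟨_, (Nat.sub_add_cancel hk1).symm⟩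
  rw [hjk] at hkle ⊢
  have hj2 : 2 * (j + 1) ≤ m := by
    have : (2 : ℝ) * ((j + 1 : ℕ) : ℝ) ≤ m := by nlinarith
    exact_mod_cast this
  push_cast at hkle ⊢
  have hjm : j + 1 < m := by omega
  have hE : cg * √(Real.log (2 / b)) ≤
      ∫ y, absOrd y ⟨j, by omega⟩ ∂(stdGaussianPi m) := by
    refine le_trans ?_ (hcgProp m ⟨j, by omega⟩ hj2)
    gcongr cg * √(Real.log ?_)
    rw [div_le_div_iff₀ hb0 (by positivity)]
    push_cast
    linarith
  have hmain := order_stat_bound (ε := ε) (β := b) (⟨j, by omega⟩ : Fin m)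
    (mul_pos hcg (Real.sqrt_pos.2 hlog)) hE hkle hjm
  rw [mul_pow, Real.sq_sqrt hlog.le] at hmain
  have hP : 1 - C * Real.exp (-r * m) ≤ (stdGaussianPi m).real (coordEvent m ε b) := by
    have h := hM m hmM
    rw [gaussianMatrix_omegaEvent x₀ hx₀, ENNReal.ofReal_le_iff_le_toReal (by finiteness)] at h
    rw [hr, ← neg_mul]
    exact h
  have hjm' : (j : ℝ) + 1 < m := by exact_mod_cast hjm
  have hge : 0 ≤ (1 - ε) * ((m : ℝ) - (j + 1)) :=
    mul_nonneg (by linarith) (by linarith)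
  have hfin := (add_le_add_right (mul_le_mul_of_nonneg_right hP hge) _).trans hmain
  have heq : ((j : ℝ) + 1) / m * (cg ^ 2 * Real.log (2 / b)) +
      (1 - C * Real.exp (-r * m)) * ((1 - ε) * (1 - ((j : ℝ) + 1) / m)) =
      (((j : ℝ) + 1) * (cg ^ 2 * Real.log (2 / b)) +
      (1 - C * Real.exp (-r * m)) * ((1 - ε) * (m - ((j : ℝ) + 1)))) / m := by
    field_simp
  rw [heq, div_le_one hm0]
  exact hfin

lemma log_bound_inv_of_admissible {n : ℕ} {x₀ : Fin n → ℝ} (hx₀ : ∑ j, x₀ j ^ 2 = 1)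
    {cg : ℝ} (hcg : 0 < cg) (hcgProp : cgProperty cg) {ε α C x : ℝ} (hα : 0 < α)
    (hε0 : 0 < ε) (hε1 : ε < 1) (hb : x⁻¹ ∈ admissible n x₀ ε α C) (hx : 2 ≤ x) :
    cg ^ 2 * Real.log (2 * x) - 1 ≤ ε * (x - 1) := by
  have hx0 : 0 < x := by linarith
  have h := log_bound_of_admissible hx₀ hcg hcgProp hα hε0 hε1 hb
    (by rw [one_div]; exact inv_anti₀ two_pos hx)
  rw [div_inv_eq_mul, inv_mul_le_iff₀ hx0] at h
  have : x * (ε + (1 - ε) * x⁻¹) = x * ε + (1 - ε) := by field_simp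
  linarith

theorem betaMaxC_upper_bound (n : ℕ) (x₀ : Fin n → ℝ) (hx₀ : ∑ j, x₀ j ^ 2 = 1)
    (cg : ℝ) (hcg : 0 < cg) (hcgProp : cgProperty cg)
    (εg : ℝ)
    (hεg : εg = sSup {t : ℝ | ∃ x : ℝ, 2 ≤ x ∧ t = (cg ^ 2 * Real.log (2 * x) - 1) / (x - 1)})
    (α C : ℝ) (hα : 0 < α) (hC : 0 < C)
    (ε : ℝ) (hε0 : 0 < ε) (hε1 : ε < min 1 εg) :
    betaMaxC n x₀ ε α C < (1 + εg⁻¹) * ε / (cg ^ 2 * Real.log (2 * εg / ε)) := by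
  obtain ⟨hε1, hεεg⟩ := lt_min_iff.1 hε1
  have hεg0 : 0 < εg := hε0.trans hεεg
  set D := cg ^ 2 * Real.log (2 * εg / ε) with hD
  have hratio : 1 < εg / ε := (one_lt_div hε0).2 hεεg
  have hD0 : 0 < D := mul_pos (pow_pos hcg 2)
    (Real.log_pos (by rw [mul_div_assoc]; linarith))
  set N := (1 + εg⁻¹) * ε with hN
  have hN0 : 0 < N := by positivity
  have key : ∀ β ∈ admissible n x₀ ε α C, β ≤ N / (N + D) := by
    intro β hβ
    have hβ0 : 0 < β := hβ.1
    obtain ⟨x, rfl⟩ : ∃ x, β = x⁻¹ := ⟨β⁻¹, (inv_inv β).symm⟩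
    have hx0 : 0 < x := inv_pos.1 hβ0
    have hpoint : ∀ t, ε ≤ t → t < εg →
        ∃ z, 2 ≤ z ∧ z < x ∧ t * (z - 1) < cg ^ 2 * Real.log (2 * z) - 1 := by
      intro t hεt ht
      rw [hεg] at ht
      obtain ⟨_, ⟨z, hz, rfl⟩, htz⟩ := exists_lt_of_lt_csSup (by exact ⟨_, 2, le_rfl, rfl⟩) ht
      rw [lt_div_iff₀ (by linarith)] at htz
      refine ⟨z, hz, ?_, htz⟩
      by_contra! hxz
      have := log_bound_inv_of_admissible hx₀ hcg hcgProp hα hε0 hε1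
        (admissible_of_le hβ (inv_pos.2 (by linarith)) (inv_anti₀ hx0 hxz)) hz
      nlinarith
    obtain ⟨z₀, hz₀, hz₀x, -⟩ := hpoint ε le_rfl hεεg
    have hlogx := log_bound_inv_of_admissible hx₀ hcg hcgProp hα hε0 hε1 hβ (by linarith)
    have hεgx : εg ≤ ε * (x - 1) := by
      refine le_of_forall_lt fun t ht => ?_
      obtain ⟨z, hz, hzx, htz⟩ := hpoint (max t ε) (le_max_right _ _) (max_lt ht hεεg)
      have hlog : cg ^ 2 * Real.log (2 * z) ≤ cg ^ 2 * Real.log (2 * x) := by gcongr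
      have : max t ε * 1 ≤ max t ε * (z - 1) := by gcongr; linarith
      linarith [le_max_left t ε]
    have hDx : D ≤ cg ^ 2 * Real.log (2 * x) := by
      rw [hD]
      gcongr
      rw [div_le_iff₀ hε0]
      nlinarith
    have hinv : 1 ≤ εg⁻¹ * (ε * (x - 1)) := by
      rw [inv_mul_eq_div, one_le_div hεg0]
      exact hεgx
    have hDN : D ≤ N * (x - 1) := by
      rw [hN]
      linarith
    rw [le_div_iff₀ (by positivity), inv_mul_le_iff₀ hx0]
    linarith
  have hbound : betaMaxC n x₀ ε α C ≤ N / (N + D) :=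
    Real.sSup_le key (by positivity)
  refine hbound.trans_lt ?_
  gcongr
  linarith
end

section
/- Let n ∈ ℕ, fix x₀ ∈ ℝ^n with ‖x₀‖ = 1, and for each m ∈ ℕ let A be an m×n Gaussian random matrix. Let 0 < α < 1 and 0 < ε ≤ min(1, 2(1 − √α)/α). If 0 < β < 1 satisfies β ln(e/β) ≤ (ε/2)(√(1 − √α) − √(αε/2))², then P(Ω̊_{ε,β}) ≥ 1 − 3e^{−α(ε²/4 − ε³/6)m} for every m ∈ ℕ. Consequently, β̊^max_{ε,α} > ((1 − √α)/32)·ε/ln(1/ε) for every 0 < ε ≤ (1 − √α)/4. -/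
open MeasureTheory ProbabilityTheory Real

/-- The event `Ω̊_{ε,β}`: `|(1/m)‖A_T x₀‖² − 1| ≤ ε` for all `T` with `|Tᶜ| ≤ βm`. -/
def omegaRingEvent (m n : ℕ) (x₀ : Fin n → ℝ) (ε β : ℝ) : Set (Fin m → Fin n → ℝ) :=
  {A | ∀ T : Finset (Fin m), (Tᶜ.card : ℝ) ≤ β * m →
    |(1 / (m : ℝ)) * subNormSq A x₀ T - 1| ≤ ε}

/-- `β̊^max_{ε,α}` (with `sSup ∅ = 0` in `ℝ`). -/
noncomputable def betaRingMax (n : ℕ) (x₀ : Fin n → ℝ) (ε α : ℝ) : ℝ :=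
  sSup {β : ℝ | 0 ≤ β ∧ β < 1 ∧ ∀ m : ℕ, 0 < m →
    ENNReal.ofReal (1 - 3 * Real.exp (-α * (ε ^ 2 / 4 - ε ^ 3 / 6) * m)) ≤
      gaussianMatrix m n (omegaRingEvent m n x₀ ε β)}

/-- The inner product of a standard Gaussian vector with a unit vector is standard Gaussian. -/
lemma map_sum_mul_pi_gaussianReal {n : ℕ} {x : Fin n → ℝ} (hx : ∑ j, x j ^ 2 = 1) :
    (Measure.pi fun _ : Fin n => gaussianReal 0 1).map (fun a => ∑ j, a j * x j) =
      gaussianReal 0 1 := by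
  have hmeas : Measurable fun a : Fin n → ℝ => ∑ j, a j * x j := by fun_prop
  have : IsProbabilityMeasure
      ((Measure.pi fun _ : Fin n => gaussianReal 0 1).map (fun a => ∑ j, a j * x j)) :=
    Measure.isProbabilityMeasure_map hmeas.aemeasurable
  refine Measure.ext_of_charFun (funext fun t => ?_)
  rw [charFun_apply_real, integral_map hmeas.aemeasurable (by fun_prop)]
  have hprod : ∀ a : Fin n → ℝ,
      Complex.exp (t * ((∑ j, a j * x j : ℝ) : ℂ) * Complex.I) =
        ∏ j, Complex.exp (((t * x j : ℝ) : ℂ) * (a j : ℂ) * Complex.I) := by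
    intro a
    rw [← Complex.exp_sum]
    congr 1
    push_cast
    rw [Finset.mul_sum, Finset.sum_mul]
    exact Finset.sum_congr rfl fun j _ => by ring
  simp_rw [hprod]
  rw [integral_fintype_prod_eq_prod
    (fun j (y : ℝ) => Complex.exp (((t * x j : ℝ) : ℂ) * (y : ℂ) * Complex.I))]
  simp_rw [← charFun_apply_real, charFun_gaussianReal]
  rw [← Complex.exp_sum]
  congr 1
  have hx' : ∑ j, (x j : ℂ) ^ 2 = 1 := by exact_mod_cast hx
  simp only [Complex.ofReal_zero, mul_zero, zero_mul, zero_sub, Finset.sum_neg_distrib,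
    NNReal.coe_one, Complex.ofReal_one, one_mul, Complex.ofReal_mul, mul_pow]
  rw [← Finset.sum_div, ← Finset.mul_sum, hx', mul_one]

/-- The image of a unit vector under a Gaussian matrix is a standard Gaussian vector. -/
lemma map_gaussianMatrix {m n : ℕ} {x : Fin n → ℝ} (hx : ∑ j, x j ^ 2 = 1) :
    (gaussianMatrix m n).map (fun A i => ∑ j, A i j * x j) =
      Measure.pi fun _ : Fin m => gaussianReal 0 1 := by
  have hmeas : Measurable fun a : Fin n → ℝ => ∑ j, a j * x j := by fun_prop
  have : IsProbabilityMeasure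
      ((Measure.pi fun _ : Fin n => gaussianReal 0 1).map (fun a => ∑ j, a j * x j)) :=
    Measure.isProbabilityMeasure_map hmeas.aemeasurable
  rw [gaussianMatrix, Measure.pi_map_pi (f := fun _ : Fin m => fun a : Fin n → ℝ =>
    ∑ j, a j * x j) fun _ => hmeas.aemeasurable]
  simp_rw [map_sum_mul_pi_gaussianReal hx]

/-- Chernoff's bound for a sum of i.i.d. variables. -/
lemma measure_pi_le_sum_le_exp {m : ℕ} {ν : Measure ℝ} [IsProbabilityMeasure ν] {φ : ℝ → ℝ}
    (hφ : Integrable (fun x => exp (φ x)) ν) {c d : ℝ} (hd : ∫ x, exp (φ x) ∂ν ≤ exp d) :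
    (Measure.pi fun _ : Fin m => ν) {x | c * m ≤ ∑ i, φ (x i)} ≤
      ENNReal.ofReal (exp ((d - c) * m)) := by
  have hexp : ∀ x : Fin m → ℝ, exp (1 * ∑ i, φ (x i)) = ∏ i, exp (φ (x i)) := fun x => by
    rw [one_mul, Real.exp_sum]
  have h := measure_ge_le_exp_mul_mgf (μ := Measure.pi fun _ : Fin m => ν)
    (X := fun x => ∑ i, φ (x i)) (t := 1) (c * m) zero_le_one (by
      simp_rw [hexp]
      exact Integrable.fintype_prod fun _ => hφ)
  rw [mgf] at h
  simp_rw [hexp] at h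
  rw [integral_fintype_prod_eq_pow (fun y : ℝ => exp (φ y)), Fintype.card_fin] at h
  rw [← ENNReal.ofReal_toReal (measure_ne_top _ {x : Fin m → ℝ | c * m ≤ ∑ i, φ (x i)})]
  refine ENNReal.ofReal_le_ofReal (h.trans ?_)
  calc exp (-1 * (c * m)) * (∫ x, exp (φ x) ∂ν) ^ m
      ≤ exp (-1 * (c * m)) * exp d ^ m := by
        gcongr
    _ = exp ((d - c) * m) := by
        rw [← Real.exp_nat_mul, ← Real.exp_add]
        ring_nf

lemma gaussianPDFReal_smul_exp_sq (l x : ℝ) :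
    gaussianPDFReal 0 1 x • exp (l * x ^ 2) =
      (√(2 * π))⁻¹ * exp (-((1 - 2 * l) / 2) * x ^ 2) := by
  rw [gaussianPDFReal_def, smul_eq_mul, NNReal.coe_one, mul_assoc, ← Real.exp_add]
  ring_nf

lemma integrable_exp_mul_sq_gaussianReal {l : ℝ} (hl : l < 1 / 2) :
    Integrable (fun x => exp (l * x ^ 2)) (gaussianReal 0 1) := by
  rw [gaussianReal_of_var_ne_zero _ one_ne_zero, integrable_withDensity_iff_integrable_smul'
    (measurable_gaussianPDF _ _) (ae_of_all _ fun x => gaussianPDF_lt_top)]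
  simp_rw [toReal_gaussianPDF, gaussianPDFReal_smul_exp_sq]
  exact (integrable_exp_neg_mul_sq (by linarith)).const_mul _

lemma integral_exp_mul_sq_gaussianReal {l : ℝ} (hl : l < 1 / 2) :
    ∫ x, exp (l * x ^ 2) ∂gaussianReal 0 1 = exp (-(log (1 - 2 * l)) / 2) := by
  have h : 0 < 1 - 2 * l := by linarith
  rw [integral_gaussianReal_eq_integral_smul one_ne_zero]
  simp_rw [gaussianPDFReal_smul_exp_sq]
  rw [integral_const_mul, integral_gaussian, ← Real.sqrt_inv, ← Real.sqrt_mul (by positivity),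
    show (2 * π)⁻¹ * (π / ((1 - 2 * l) / 2)) = (1 - 2 * l)⁻¹ by field_simp,
    ← Real.log_inv, ← Real.exp_log (Real.sqrt_pos.2 (inv_pos.2 h)), Real.log_sqrt (by positivity)]

lemma gaussianReal_Ici_le {t : ℝ} (ht : 0 ≤ t) :
    gaussianReal 0 1 (Set.Ici t) ≤
      ENNReal.ofReal (exp (-t ^ 2 / 2)) * gaussianReal 0 1 (Set.Ici 0) := by
  have h1 : gaussianReal 0 1 (Set.Ici t) = gaussianReal (-t) 1 (Set.Ici 0) := by
    have := gaussianReal_map_add_const (μ := 0) (v := 1) (-t)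
    rw [zero_add] at this
    rw [← this, Measure.map_apply (by fun_prop) measurableSet_Ici]
    congr 1
    ext x
    simp
  rw [h1, gaussianReal_apply _ one_ne_zero, gaussianReal_apply _ one_ne_zero,
    ← lintegral_const_mul _ (measurable_gaussianPDF _ _)]
  refine setLIntegral_mono ((measurable_gaussianPDF _ _).const_mul _) fun x hx => ?_
  rw [gaussianPDF_def, gaussianPDF_def, ← ENNReal.ofReal_mul (exp_pos _).le]
  refine ENNReal.ofReal_le_ofReal ?_
  simp only [gaussianPDFReal_def]
  rw [mul_left_comm, ← Real.exp_add]
  have : 0 ≤ x * t := mul_nonneg hx ht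
  gcongr
  simp only [NNReal.coe_one]
  linarith

/-- The two-sided Gaussian tail bound with constant one. -/
lemma gaussianReal_le_sq_le {u : ℝ} (hu : 0 ≤ u) :
    gaussianReal 0 1 {x | u ≤ x ^ 2} ≤ ENNReal.ofReal (exp (-u / 2)) := by
  have hneg : ∀ t : ℝ, gaussianReal 0 1 (Set.Iic (-t)) = gaussianReal 0 1 (Set.Ici t) := by
    intro t
    have := gaussianReal_map_neg (μ := 0) (v := 1)
    rw [neg_zero] at this
    conv_lhs => rw [← this, Measure.map_apply measurable_neg measurableSet_Iic]
    congr 1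
    ext x
    simp
  have : NullSingletonClass (gaussianReal 0 1) := nullSingletonClass_gaussianReal one_ne_zero
  have hone : gaussianReal 0 1 (Set.Ici 0) + gaussianReal 0 1 (Set.Ici 0) = 1 := by
    have hIio : gaussianReal 0 1 (Set.Ici 0) = gaussianReal 0 1 (Set.Iio 0) := by
      rw [Iio_ae_eq_Iic.measure_eq, ← hneg 0, neg_zero]
    nth_rw 1 [hIio]
    rw [← measure_union (Set.Iio_disjoint_Ici le_rfl) measurableSet_Ici,
      Set.Iio_union_Ici, measure_univ]
  have hsub : {x : ℝ | u ≤ x ^ 2} ⊆ Set.Ici √u ∪ Set.Iic (-√u) := by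
    intro x hx
    have : √u ≤ |x| := Real.sqrt_le_iff.2 ⟨abs_nonneg _, by rwa [sq_abs]⟩
    rcases le_abs.1 this with h | h
    · exact Or.inl h
    · exact Or.inr (le_neg.1 h)
  calc gaussianReal 0 1 {x | u ≤ x ^ 2}
      ≤ gaussianReal 0 1 (Set.Ici √u) + gaussianReal 0 1 (Set.Ici √u) := by
        refine (measure_mono hsub).trans ((measure_union_le _ _).trans ?_)
        rw [hneg]
    _ ≤ ENNReal.ofReal (exp (-√u ^ 2 / 2)) *
          (gaussianReal 0 1 (Set.Ici 0) + gaussianReal 0 1 (Set.Ici 0)) := by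
        rw [mul_add]
        exact add_le_add (gaussianReal_Ici_le (Real.sqrt_nonneg _))
          (gaussianReal_Ici_le (Real.sqrt_nonneg _))
    _ = ENNReal.ofReal (exp (-u / 2)) := by rw [hone, mul_one, Real.sq_sqrt hu]

lemma lintegral_exp_excess_gaussianReal_le {l τ : ℝ} (hl0 : 0 ≤ l) (hl : l < 1 / 2) (hτ : 0 ≤ τ) :
    ∫⁻ x, ENNReal.ofReal (exp (l * max (x ^ 2 - τ) 0) - 1) ∂gaussianReal 0 1 ≤
      ENNReal.ofReal (2 * l / (1 - 2 * l) * exp (-τ / 2)) := by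
  have hint : ∀ y : ℝ, ∫ t in (0 : ℝ)..y, l * exp (l * t) = exp (l * y) - 1 := by
    intro y
    have := intervalIntegral.integral_eq_sub_of_hasDerivAt (a := 0) (b := y)
      (f := fun t => exp (l * t)) (f' := fun t => l * exp (l * t)) (fun t _ => by
        have := ((hasDerivAt_id t).const_mul l).exp
        simpa [mul_comm] using this) (Continuous.intervalIntegrable (by fun_prop) _ _)
    simp [this]
  have hcake := lintegral_comp_eq_lintegral_meas_le_mul (gaussianReal 0 1)
    (f := fun x : ℝ => max (x ^ 2 - τ) 0) (g := fun t => l * exp (l * t))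
    (ae_of_all _ fun x => le_max_right _ _) (by fun_prop)
    (fun t _ => Continuous.intervalIntegrable (by fun_prop) _ _)
    (ae_of_all _ fun t => by positivity)
  simp_rw [hint] at hcake
  have hneg : l - 1 / 2 < 0 := by linarith
  rw [hcake]
  calc ∫⁻ t in Set.Ioi 0, gaussianReal 0 1 {x | t ≤ max (x ^ 2 - τ) 0} *
        ENNReal.ofReal (l * exp (l * t))
      ≤ ∫⁻ t in Set.Ioi 0, ENNReal.ofReal (l * exp (-τ / 2) * exp ((l - 1 / 2) * t)) := by
        refine setLIntegral_mono (by fun_prop) fun t ht => ?_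
        have ht : 0 < t := ht
        have hset : {x : ℝ | t ≤ max (x ^ 2 - τ) 0} ⊆ {x | τ + t ≤ x ^ 2} := by
          intro x hx
          have hx : t ≤ max (x ^ 2 - τ) 0 := hx
          rcases le_max_iff.1 hx with h | h
          · exact (by linarith : τ + t ≤ x ^ 2)
          · linarith
        calc _ ≤ ENNReal.ofReal (exp (-(τ + t) / 2)) * ENNReal.ofReal (l * exp (l * t)) := by
              gcongr
              exact (measure_mono hset).trans (gaussianReal_le_sq_le (by linarith))
          _ = _ := by
              rw [← ENNReal.ofReal_mul (exp_pos _).le, mul_left_comm, ← Real.exp_add, mul_assoc,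
                ← Real.exp_add]
              ring_nf
    _ = ENNReal.ofReal (2 * l / (1 - 2 * l) * exp (-τ / 2)) := by
        rw [← ofReal_integral_eq_lintegral_ofReal
          ((integrableOn_exp_mul_Ioi hneg 0).const_mul _) (ae_of_all _ fun t => by positivity),
          integral_const_mul, integral_exp_mul_Ioi hneg]
        congr 1
        have h1 : (1 - 2 * l) ≠ 0 := by linarith
        have h2 : (l - 1 / 2) ≠ 0 := by linarith
        rw [mul_zero, Real.exp_zero]
        rw [show l - 1 / 2 = -(1 - 2 * l) / 2 by ring]
        field_simp

lemma integrable_exp_excess_gaussianReal {l τ : ℝ} (hl0 : 0 ≤ l) (hl : l < 1 / 2) (hτ : 0 ≤ τ) :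
    Integrable (fun x => exp (l * max (x ^ 2 - τ) 0)) (gaussianReal 0 1) := by
  refine (integrable_exp_mul_sq_gaussianReal hl).mono' (by fun_prop) (ae_of_all _ fun x => ?_)
  rw [Real.norm_eq_abs, abs_of_pos (exp_pos _)]
  gcongr
  exact max_le (by linarith) (sq_nonneg x)

lemma integral_exp_excess_gaussianReal_le {l τ : ℝ} (hl0 : 0 ≤ l) (hl : l < 1 / 2) (hτ : 0 ≤ τ) :
    ∫ x, exp (l * max (x ^ 2 - τ) 0) ∂gaussianReal 0 1 ≤
      exp (2 * l / (1 - 2 * l) * exp (-τ / 2)) := by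
  have hi := integrable_exp_excess_gaussianReal hl0 hl hτ
  have h := lintegral_exp_excess_gaussianReal_le hl0 hl hτ
  have hl' : 0 < 1 - 2 * l := by linarith
  rw [← ofReal_integral_eq_lintegral_ofReal
    (f := fun x => exp (l * max (x ^ 2 - τ) 0) - 1) (hi.sub (integrable_const 1))
    (ae_of_all _ fun x => by
      have : 0 ≤ l * max (x ^ 2 - τ) 0 := mul_nonneg hl0 (le_max_right _ _)
      simpa using this),
    ENNReal.ofReal_le_ofReal_iff (by positivity), integral_sub hi (integrable_const 1)] at h
  simp only [integral_const, probReal_univ, smul_eq_mul, mul_one] at h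
  linarith [Real.add_one_le_exp (2 * l / (1 - 2 * l) * exp (-τ / 2))]

lemma log_one_add_le_cubic {x : ℝ} (hx : 0 ≤ x) :
    log (1 + x) ≤ x - x ^ 2 / 2 + x ^ 3 / 3 := by
  have hder : ∀ y ∈ interior (Set.Ici (0 : ℝ)), HasDerivWithinAt
      (fun y => y - y ^ 2 / 2 + y ^ 3 / 3 - log (1 + y)) (y ^ 3 / (1 + y))
      (interior (Set.Ici 0)) y := by
    intro y hy
    rw [interior_Ici] at hy
    have hy : 0 < y := hy
    have h1 : (1 + y) ≠ 0 := by positivity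
    have h := ((((hasDerivAt_id y).sub (((hasDerivAt_id y).pow 2).div_const 2)).add
      (((hasDerivAt_id y).pow 3).div_const 3)).sub (((hasDerivAt_id y).const_add 1).log h1))
    refine (h.congr_deriv ?_).hasDerivWithinAt
    simp only [id]
    field_simp
    ring
  have hmono := monotoneOn_of_hasDerivWithinAt_nonneg (convex_Ici (0 : ℝ))
    (f := fun y => y - y ^ 2 / 2 + y ^ 3 / 3 - log (1 + y)) (by
      refine ContinuousOn.sub (by fun_prop) (ContinuousOn.log (by fun_prop) fun y hy => ?_)
      have : (0 : ℝ) ≤ y := hy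
      positivity) hder (fun y hy => by
      rw [interior_Ici] at hy
      have hy : 0 < y := hy
      positivity)
  have := hmono (Set.self_mem_Ici) hx hx
  simp only [add_zero, Real.log_one] at this
  linarith

lemma log_one_sub_le_quadratic {t : ℝ} (ht0 : 0 ≤ t) (ht1 : t < 1) :
    log (1 - t) ≤ -t - t ^ 2 / 2 := by
  have h := sum_le_hasSum (Finset.range 2) (fun i _ => by positivity)
    (hasSum_pow_div_log_of_abs_lt_one (x := t) (by rwa [abs_of_nonneg ht0]))
  norm_num [Finset.sum_range_succ] at h
  linarith

lemma log_exp_one_div {β : ℝ} (hβ : 0 < β) : log (exp 1 / β) = 1 - log β := by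
  rw [Real.log_div (exp_ne_zero _) hβ.ne', Real.log_exp]

lemma excess_exponent_le {ε β p q : ℝ} (hε : 0 < ε) (hβ0 : 0 < β) (hβ1 : β < 1)
    (hq : 0 < q) (hqp : q < p) (h : β * log (exp 1 / β) ≤ ε / 2 * (p - q) ^ 2) :
    q / p * β - q / p / 2 * (ε * p ^ 2 + 2 * β * log (β * (1 - q / p))) ≤ -(ε * q ^ 2 / 2) := by
  have hp : 0 < p := hq.trans hqp
  have hpq : 0 < p - q := sub_pos.2 hqp
  have hμ : 1 - q / p = (p - q) / p := by field_simp
  have hlog : -(q / (p - q)) ≤ log (1 - q / p) := by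
    have := one_sub_inv_le_log_of_pos (show 0 < (p - q) / p by positivity)
    rw [hμ]
    refine le_trans (le_of_eq ?_) this
    field_simp
    ring
  rw [log_exp_one_div hβ0] at h
  rw [Real.log_mul hβ0.ne' (by rw [hμ]; positivity)]
  have hlogβ : log β < 0 := Real.log_neg hβ0 hβ1
  have hβ : 2 * β ≤ ε * (p - q) ^ 2 := by nlinarith
  have h2 : 2 * β * (q / (p - q)) ≤ ε * (p - q) * q := by
    calc 2 * β * (q / (p - q)) ≤ ε * (p - q) ^ 2 * (q / (p - q)) := by gcongr
      _ = ε * (p - q) * q := by field_simp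
  have h3 : -(2 * β * (q / (p - q))) ≤ 2 * β * log (1 - q / p) := by
    have := mul_le_mul_of_nonneg_left hlog (by positivity : 0 ≤ 2 * β)
    linarith
  have h4 : ε * p * q ≤ ε * p ^ 2 + 2 * β * (log β + log (1 - q / p)) - 2 * β := by
    nlinarith
  have h5 : q / p / 2 * (ε * p * q) = ε * q ^ 2 / 2 := by field_simp
  have h6 := mul_le_mul_of_nonneg_left h4 (by positivity : 0 ≤ q / p / 2)
  linarith

/-- If the sum of squares over some large index set deviates from `m` by more than `ε m`, then
either the total sum of squares is large, or it is small, or the squares exceed the level `τ`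
by a large total amount. -/
lemma deviation_cases {m : ℕ} {ε r β τ : ℝ} (hτ : 0 ≤ τ) (x : Fin m → ℝ) (T : Finset (Fin m))
    (hT : (Tᶜ.card : ℝ) ≤ β * m) (hm : 0 < m)
    (h : ε < |(1 / (m : ℝ)) * ∑ i ∈ T, x i ^ 2 - 1|) :
    (1 + ε) * m ≤ ∑ i, x i ^ 2 ∨ ∑ i, x i ^ 2 ≤ (1 - r * ε) * m ∨
      ((1 - r) * ε - β * τ) * m ≤ ∑ i, max (x i ^ 2 - τ) 0 := by
  have hm' : (0 : ℝ) < m := by exact_mod_cast hm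
  have hsplit := Finset.sum_add_sum_compl T fun i => x i ^ 2
  rw [one_div_mul_eq_div] at h
  rcases lt_abs.1 h with h | h
  · left
    have h1 : (1 + ε) < (∑ i ∈ T, x i ^ 2) / m := by linarith
    rw [lt_div_iff₀ hm'] at h1
    have : 0 ≤ ∑ i ∈ Tᶜ, x i ^ 2 := Finset.sum_nonneg fun i _ => sq_nonneg _
    linarith
  · right
    have h1 : (∑ i ∈ T, x i ^ 2) / m < 1 - ε := by linarith
    rw [div_lt_iff₀ hm'] at h1
    by_contra! hcon
    obtain ⟨hc1, hc2⟩ := hcon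
    have hexc : ∑ i ∈ Tᶜ, x i ^ 2 ≤ Tᶜ.card * τ + ∑ i, max (x i ^ 2 - τ) 0 := by
      calc ∑ i ∈ Tᶜ, x i ^ 2 ≤ ∑ i ∈ Tᶜ, (τ + max (x i ^ 2 - τ) 0) :=
            Finset.sum_le_sum fun i _ => by linarith [le_max_left (x i ^ 2 - τ) 0]
        _ = Tᶜ.card * τ + ∑ i ∈ Tᶜ, max (x i ^ 2 - τ) 0 := by
            rw [Finset.sum_add_distrib, Finset.sum_const, nsmul_eq_mul]
        _ ≤ _ := by
            gcongr
            exact Finset.subset_univ _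
    have := mul_le_mul_of_nonneg_right hT hτ
    nlinarith

lemma measure_upper_le {m : ℕ} {ε : ℝ} (hε : 0 < ε) :
    (Measure.pi fun _ : Fin m => gaussianReal 0 1) {x | (1 + ε) * m ≤ ∑ i, x i ^ 2} ≤
      ENNReal.ofReal (exp (-(ε ^ 2 / 4 - ε ^ 3 / 6) * m)) := by
  have h1 : (1 + ε) ≠ 0 := by positivity
  have hl : ε / (2 * (1 + ε)) < 1 / 2 := by
    rw [div_lt_div_iff₀ (by positivity) (by positivity)]
    linarith
  have h := measure_pi_le_sum_le_exp (m := m) (c := ε / 2)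
    (integrable_exp_mul_sq_gaussianReal hl) (integral_exp_mul_sq_gaussianReal hl).le
  have hlog : -log (1 - 2 * (ε / (2 * (1 + ε)))) = log (1 + ε) := by
    rw [← Real.log_inv]
    congr 1
    field_simp
    ring
  rw [hlog] at h
  refine (measure_mono fun x hx => ?_).trans (h.trans (ENNReal.ofReal_le_ofReal ?_))
  · simp only [Set.mem_ofPred_eq] at hx ⊢
    rw [← Finset.mul_sum]
    calc ε / 2 * m = ε / (2 * (1 + ε)) * ((1 + ε) * m) := by field_simp
      _ ≤ _ := by gcongr
  · gcongr
    linarith [log_one_add_le_cubic hε.le]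

lemma measure_lower_le {m : ℕ} {t : ℝ} (ht0 : 0 ≤ t) (ht1 : t < 1) :
    (Measure.pi fun _ : Fin m => gaussianReal 0 1) {x | ∑ i, x i ^ 2 ≤ (1 - t) * m} ≤
      ENNReal.ofReal (exp (-(t ^ 2 / 4) * m)) := by
  have h1 : 0 < 1 - t := by linarith
  have hl0 : -(t / (2 * (1 - t))) ≤ 0 := neg_nonpos.2 (by positivity)
  have hl : -(t / (2 * (1 - t))) < 1 / 2 := by linarith
  have h := measure_pi_le_sum_le_exp (m := m) (c := -(t / 2))
    (integrable_exp_mul_sq_gaussianReal hl) (integral_exp_mul_sq_gaussianReal hl).le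
  have hlog : -log (1 - 2 * -(t / (2 * (1 - t)))) = log (1 - t) := by
    rw [← Real.log_inv]
    congr 1
    field_simp
    ring
  rw [hlog] at h
  refine (measure_mono fun x hx => ?_).trans (h.trans (ENNReal.ofReal_le_ofReal ?_))
  · simp only [Set.mem_ofPred_eq] at hx ⊢
    rw [← Finset.mul_sum]
    calc -(t / 2) * m = -(t / (2 * (1 - t))) * ((1 - t) * m) := by field_simp
      _ ≤ _ := mul_le_mul_of_nonpos_left hx hl0
  · gcongr
    linarith [log_one_sub_le_quadratic ht0 ht1]

lemma measure_excess_le {m : ℕ} {ε β p q : ℝ} (hε : 0 < ε) (hβ0 : 0 < β) (hβ1 : β < 1)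
    (hq : 0 < q) (hqp : q < p) (h : β * log (exp 1 / β) ≤ ε / 2 * (p - q) ^ 2) :
    (Measure.pi fun _ : Fin m => gaussianReal 0 1)
      {x | (p ^ 2 * ε - β * (-2 * log (β * (1 - q / p)))) * m ≤
        ∑ i, max (x i ^ 2 - -2 * log (β * (1 - q / p))) 0} ≤
      ENNReal.ofReal (exp (-(ε * q ^ 2 / 2) * m)) := by
  have hp : 0 < p := hq.trans hqp
  have hμ1 : q / p < 1 := (div_lt_one hp).2 hqp
  have hμ0 : 0 < q / p := by positivity
  have hpos : 0 < β * (1 - q / p) := mul_pos hβ0 (by linarith)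
  have hτ : 0 ≤ -2 * log (β * (1 - q / p)) := by
    have := Real.log_nonpos hpos.le (by nlinarith)
    linarith
  have hl0 : 0 ≤ q / p / 2 := by positivity
  have hl : q / p / 2 < 1 / 2 := by linarith
  have hch := measure_pi_le_sum_le_exp (m := m)
    (c := q / p / 2 * (p ^ 2 * ε - β * (-2 * log (β * (1 - q / p)))))
    (integrable_exp_excess_gaussianReal hl0 hl hτ) (integral_exp_excess_gaussianReal_le hl0 hl hτ)
  have hd : 2 * (q / p / 2) / (1 - 2 * (q / p / 2)) *
      exp (-(-2 * log (β * (1 - q / p))) / 2) = q / p * β := by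
    rw [show -(-2 * log (β * (1 - q / p))) / 2 = log (β * (1 - q / p)) by ring, Real.exp_log hpos,
      mul_div_cancel₀ _ two_ne_zero]
    have : 1 - q / p ≠ 0 := by linarith
    generalize q / p = μ at *
    field_simp
  rw [hd] at hch
  refine (measure_mono fun x hx => ?_).trans (hch.trans (ENNReal.ofReal_le_ofReal ?_))
  · simp only [Set.mem_ofPred_eq] at hx ⊢
    rw [← Finset.mul_sum, mul_assoc]
    gcongr
  · gcongr
    have := excess_exponent_le hε hβ0 hβ1 hq hqp h
    linarith

theorem omegaRingEvent_prob_ge {m n : ℕ} (hm : 0 < m) {x₀ : Fin n → ℝ}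
    (hx₀ : ∑ j, x₀ j ^ 2 = 1) {α : ℝ} (hα0 : 0 < α) (hα1 : α < 1) {ε : ℝ} (hε0 : 0 < ε)
    (hε : ε ≤ min 1 (2 * (1 - √α) / α)) {β : ℝ} (hβ0 : 0 < β) (hβ1 : β < 1)
    (hβ : β * log (exp 1 / β) ≤ (ε / 2) * (√(1 - √α) - √(α * ε / 2)) ^ 2) :
    ENNReal.ofReal (1 - 3 * exp (-α * (ε ^ 2 / 4 - ε ^ 3 / 6) * m)) ≤
      gaussianMatrix m n (omegaRingEvent m n x₀ ε β) := by
  have hε1 : ε ≤ 1 := hε.trans (min_le_left _ _)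
  have hε2 : α * ε / 2 ≤ 1 - √α := by
    have := (le_div_iff₀ hα0).1 (hε.trans (min_le_right _ _))
    linarith
  have hr0 : 0 < √α := Real.sqrt_pos.2 hα0
  have hr1 : √α < 1 := (Real.sqrt_lt' one_pos).2 (by simpa using hα1)
  have hrsq : √α ^ 2 = α := Real.sq_sqrt hα0.le
  set p := √(1 - √α) with hp
  set q := √(α * ε / 2) with hq
  have hpsq : p ^ 2 = 1 - √α := Real.sq_sqrt (by linarith)
  have hqsq : q ^ 2 = α * ε / 2 := Real.sq_sqrt (by positivity)
  have hq0 : 0 < q := Real.sqrt_pos.2 (by positivity)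
  have hlogβ : log β < 0 := Real.log_neg hβ0 hβ1
  have hqp : q < p := by
    refine lt_of_le_of_ne (Real.sqrt_le_sqrt hε2) fun heq => ?_
    rw [heq, sub_self, log_exp_one_div hβ0] at hβ
    nlinarith
  have hp0 : 0 < p := hq0.trans hqp
  have hμ1 : q / p < 1 := (div_lt_one hp0).2 hqp
  have hμ0 : 0 < q / p := by positivity
  have hpos : 0 < β * (1 - q / p) := mul_pos hβ0 (by linarith)
  have hτ : 0 ≤ -2 * log (β * (1 - q / p)) := by
    have := Real.log_nonpos hpos.le (by nlinarith)
    linarith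
  set δ := ENNReal.ofReal (exp (-α * (ε ^ 2 / 4 - ε ^ 3 / 6) * m)) with hδ
  have hc : 0 ≤ ε ^ 2 / 4 - ε ^ 3 / 6 := by nlinarith [sq_nonneg ε]
  have hc' : ε ^ 2 / 4 - ε ^ 3 / 6 ≤ ε ^ 2 / 4 := by linarith [pow_pos hε0 3]
  have hup := (measure_upper_le (m := m) hε0).trans (ENNReal.ofReal_le_ofReal
    (Real.exp_le_exp.2 (mul_le_mul_of_nonneg_right (b := -(ε ^ 2 / 4 - ε ^ 3 / 6))
      (c := -α * (ε ^ 2 / 4 - ε ^ 3 / 6)) (by nlinarith) m.cast_nonneg)))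
  have hlo := (measure_lower_le (m := m) (t := √α * ε) (by positivity) (by nlinarith)).trans
    (ENNReal.ofReal_le_ofReal (Real.exp_le_exp.2 (mul_le_mul_of_nonneg_right
      (c := -α * (ε ^ 2 / 4 - ε ^ 3 / 6)) (by rw [mul_pow, hrsq]; nlinarith) m.cast_nonneg)))
  have hex := (measure_excess_le (m := m) hε0 hβ0 hβ1 hq0 hqp hβ).trans
    (ENNReal.ofReal_le_ofReal (Real.exp_le_exp.2 (mul_le_mul_of_nonneg_right
      (c := -α * (ε ^ 2 / 4 - ε ^ 3 / 6)) (by rw [hqsq]; nlinarith) m.cast_nonneg)))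
  rw [← hδ] at hup hlo hex
  rw [← map_gaussianMatrix hx₀] at hup hlo hex
  have hF : AEMeasurable (fun (A : Fin m → Fin n → ℝ) i => ∑ j, A i j * x₀ j)
      (gaussianMatrix m n) := Measurable.aemeasurable (by fun_prop)
  have hcompl : gaussianMatrix m n (omegaRingEvent m n x₀ ε β)ᶜ ≤ δ + (δ + δ) := by
    refine (measure_mono ?_).trans ((measure_union_le _ _).trans (add_le_add
      ((Measure.le_map_apply hF _).trans hup) ((measure_union_le _ _).trans (add_le_add
      ((Measure.le_map_apply hF _).trans hlo) ((Measure.le_map_apply hF _).trans hex)))))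
    intro A hA
    simp only [omegaRingEvent, Set.mem_compl_iff, Set.mem_ofPred_eq, not_forall, not_le] at hA
    obtain ⟨T, hT, hdev⟩ := hA
    have := deviation_cases (r := √α) hτ (fun i => ∑ j, A i j * x₀ j) T hT hm hdev
    rwa [← hpsq] at this
  have : IsProbabilityMeasure (gaussianMatrix m n) := by
    unfold gaussianMatrix
    infer_instance
  have hone : 1 ≤ gaussianMatrix m n (omegaRingEvent m n x₀ ε β) + (δ + (δ + δ)) := by
    rw [← measure_univ (μ := gaussianMatrix m n),
      ← Set.union_compl_self (omegaRingEvent m n x₀ ε β)]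
    exact (measure_union_le _ _).trans (by gcongr)
  rw [ENNReal.ofReal_sub _ (by positivity), ENNReal.ofReal_one, tsub_le_iff_right]
  refine hone.trans (le_of_eq ?_)
  rw [ENNReal.ofReal_mul (by norm_num), ← hδ]
  norm_num
  ring

theorem lt_betaRingMax {n : ℕ} {x₀ : Fin n → ℝ} (hx₀ : ∑ j, x₀ j ^ 2 = 1) {α : ℝ} (hα0 : 0 < α)
    (hα1 : α < 1) {ε : ℝ} (hε0 : 0 < ε) (hε : ε ≤ (1 - √α) / 4) :
    ((1 - √α) / 32) * (ε / log (1 / ε)) < betaRingMax n x₀ ε α := by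
  have hr0 : 0 < √α := Real.sqrt_pos.2 hα0
  have hr1 : √α < 1 := (Real.sqrt_lt' one_pos).2 (by simpa using hα1)
  have hs0 : 0 < 1 - √α := by linarith
  set s := 1 - √α with hs
  have hs1 : s < 1 := by linarith
  set ℓ := log (1 / ε) with hℓ
  have hlogε : log ε = -ℓ := by rw [hℓ, one_div, Real.log_inv, neg_neg]
  have hlog4 : log 4 = 2 * log 2 := by
    rw [show (4 : ℝ) = 2 ^ 2 by norm_num, Real.log_pow]
    norm_num
  have hlog2 := Real.log_two_gt_d9
  have hlogs : 2 * log 2 - ℓ ≤ log s := by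
    rw [← hlog4, sub_eq_add_neg, ← hlogε, ← Real.log_mul (by norm_num) hε0.ne']
    exact Real.log_le_log (by positivity) (by linarith)
  have hlogs0 : log s < 0 := Real.log_neg hs0 hs1
  have hℓ2 : 2 * log 2 < ℓ := by linarith
  have hℓ0 : 0 < ℓ := by linarith
  set β := s / 31 * (ε / ℓ) with hβ
  have hβ0 : 0 < β := by positivity
  have hεℓ : ε / ℓ < 1 := by
    rw [div_lt_one hℓ0]
    linarith
  have hβ1 : β < 1 := by
    have : 0 < ε / ℓ := by positivity
    nlinarith
  have hlogβ : log β = log s - log 31 - ℓ - log ℓ := by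
    rw [hβ, Real.log_mul (by positivity) (by positivity), Real.log_div hs0.ne' (by norm_num),
      Real.log_div hε0.ne' hℓ0.ne', hlogε]
    ring
  have hlog31 : log 31 ≤ 5 * log 2 := by
    rw [show 5 * log 2 = log (2 ^ 5) by rw [Real.log_pow]; norm_num]
    exact Real.log_le_log (by norm_num) (by norm_num)
  have hlogℓ : log ℓ ≤ ℓ - 1 := Real.log_le_sub_one_of_pos hℓ0
  have hlhs : β * log (exp 1 / β) ≤ s * ε / 5 := by
    rw [log_exp_one_div hβ0, hlogβ]
    calc β * (1 - (log s - log 31 - ℓ - log ℓ)) ≤ β * (31 / 5 * ℓ) := by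
          gcongr
          linarith
      _ = s * ε / 5 := by
          rw [hβ]
          field_simp
  have hαs : α * ε / 2 ≤ (√s * (9 / 25)) ^ 2 := by
    rw [mul_pow, Real.sq_sqrt hs0.le]
    nlinarith
  have hsqrt : √(α * ε / 2) ≤ √s * (9 / 25) := Real.sqrt_le_iff.2 ⟨by positivity, hαs⟩
  have hrhs : s * ε / 5 ≤ (ε / 2) * (√s - √(α * ε / 2)) ^ 2 := by
    have h1 : (√s * (16 / 25)) ^ 2 ≤ (√s - √(α * ε / 2)) ^ 2 :=
      pow_le_pow_left₀ (by positivity) (by linarith) 2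
    rw [mul_pow, Real.sq_sqrt hs0.le] at h1
    nlinarith
  have hmin : ε ≤ min 1 (2 * s / α) := by
    refine le_min (by linarith) ((le_div_iff₀ hα0).2 ?_)
    nlinarith
  have hmem : β ≤ betaRingMax n x₀ ε α := by
    refine le_csSup ⟨1, fun b hb => hb.2.1.le⟩ ⟨hβ0.le, hβ1, fun m hm => ?_⟩
    exact omegaRingEvent_prob_ge hm hx₀ hα0 hα1 hε0 hmin hβ0 hβ1 (hlhs.trans hrhs)
  refine lt_of_lt_of_le ?_ hmem
  have : 0 < ε / ℓ := by positivity
  rw [hβ]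
  gcongr
  norm_num

theorem betaRingMax_lower_bound (n : ℕ) (x₀ : Fin n → ℝ) (hx₀ : ∑ j, x₀ j ^ 2 = 1)
    (α : ℝ) (hα0 : 0 < α) (hα1 : α < 1) :
    (∀ ε : ℝ, 0 < ε → ε ≤ min 1 (2 * (1 - Real.sqrt α) / α) →
      ∀ β : ℝ, 0 < β → β < 1 →
        β * Real.log (Real.exp 1 / β) ≤
          (ε / 2) * (Real.sqrt (1 - Real.sqrt α) - Real.sqrt (α * ε / 2)) ^ 2 →
        ∀ m : ℕ, 0 < m →
          ENNReal.ofReal (1 - 3 * Real.exp (-α * (ε ^ 2 / 4 - ε ^ 3 / 6) * m)) ≤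
            gaussianMatrix m n (omegaRingEvent m n x₀ ε β)) ∧
    (∀ ε : ℝ, 0 < ε → ε ≤ (1 - Real.sqrt α) / 4 →
      ((1 - Real.sqrt α) / 32) * (ε / Real.log (1 / ε)) < betaRingMax n x₀ ε α) :=
  ⟨fun _ hε0 hε _ hβ0 hβ1 hβ _ hm => omegaRingEvent_prob_ge hm hx₀ hα0 hα1 hε0 hε hβ0 hβ1 hβ,
    fun _ hε0 hε => lt_betaRingMax hx₀ hα0 hα1 hε0 hε⟩
end
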